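/- Under the stated hypotheses, for integers 0 ≤ m < n, the sum S₁ = ∑_{i=m+1}^{n} β^i · ( ∑_{k=m+1}^{i} binom(i,k)·binom(k−c₁,k)/binom(n+c₁−1,k) ) · aᵢ satisfies |S₁| ≤ C_m · ( binom(n+c₂−1, n)·rⁿ·( n·ln(n) + 2n/c₁ ) + (r/n)^{m+1}·(c₂+m)_{m+1}·(1−r)^{−c₂}·(1+c₂r) ) for a constant C_m depending only on m; for m = 0 one may take C₀ = 24. -/

import Mathlib

/-- Generalized binomial coefficient `binom(x, n) = x(x-1)⋯(x-n+1)/n!` for real `x`. -/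
noncomputable def rbinom (x : ℝ) (n : ℕ) : ℝ :=
  (∏ i ∈ Finset.range n, (x - (i : ℝ))) / (Nat.factorial n : ℝ)

/-- Falling factorial `(x)_n = x(x-1)⋯(x-n+1)` for real `x`. -/
noncomputable def ffall (x : ℝ) (n : ℕ) : ℝ :=
  ∏ i ∈ Finset.range n, (x - (i : ℝ))

/-- The coefficient of `x ^ n` in `(1 - x) ^ (-s)`, that is `s(s+1)⋯(s+n-1)/n!`. -/
noncomputable def risingCoeff (s : ℝ) (n : ℕ) : ℝ :=
  (∏ j ∈ Finset.range n, (s + (j : ℝ))) / (Nat.factorial n : ℝ)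

@[simp]
theorem risingCoeff_zero (s : ℝ) : risingCoeff s 0 = 1 := by
  simp [risingCoeff]

theorem risingCoeff_nonneg {s : ℝ} (hs : 0 ≤ s) (n : ℕ) : 0 ≤ risingCoeff s n :=
  div_nonneg (Finset.prod_nonneg fun _ _ => by positivity) (by positivity)

theorem succ_mul_risingCoeff_succ (s : ℝ) (n : ℕ) :
    ((n : ℝ) + 1) * risingCoeff s (n + 1) = (s + n) * risingCoeff s n := by
  have h : (Nat.factorial n : ℝ) ≠ 0 := by positivity
  have h' : (n : ℝ) + 1 ≠ 0 := by positivity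
  rw [risingCoeff, risingCoeff, Finset.prod_range_succ, Nat.factorial_succ]
  push_cast
  field_simp

theorem succ_mul_risingCoeff_succ' (s : ℝ) (n : ℕ) :
    ((n : ℝ) + 1) * risingCoeff s (n + 1) = s * risingCoeff (s + 1) n := by
  have h : (Nat.factorial n : ℝ) ≠ 0 := by positivity
  have h' : (n : ℝ) + 1 ≠ 0 := by positivity
  have hp : ∏ j ∈ Finset.range n, (s + ((j + 1 : ℕ) : ℝ)) =
      ∏ j ∈ Finset.range n, (s + 1 + (j : ℝ)) :=
    Finset.prod_congr rfl fun j _ => by push_cast; ring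
  rw [risingCoeff, risingCoeff, Finset.prod_range_succ', hp, Nat.factorial_succ]
  push_cast
  field_simp
  ring

theorem sum_range_succ_risingCoeff (s : ℝ) (n : ℕ) :
    ∑ j ∈ Finset.range (n + 1), risingCoeff s j = risingCoeff (s + 1) n := by
  induction n with
  | zero => simp
  | succ n ih =>
    rw [Finset.sum_range_succ, ih]
    have h' : (n : ℝ) + 1 ≠ 0 := by positivity
    have h1 := succ_mul_risingCoeff_succ' s n
    have h2 := succ_mul_risingCoeff_succ (s + 1) n
    refine mul_left_cancel₀ h' ?_
    rw [mul_add, h1, h2]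
    ring

theorem rbinom_add_sub_one (s : ℝ) (n : ℕ) : rbinom ((n : ℝ) + s - 1) n = risingCoeff s n := by
  rw [rbinom, risingCoeff, ← Finset.prod_range_reflect]
  congr 1
  refine Finset.prod_congr rfl fun j hj => ?_
  have hj' : j + 1 ≤ n := Finset.mem_range.mp hj
  rw [Nat.sub_sub, Nat.cast_sub (by omega)]
  push_cast
  ring

theorem ffall_add_succ (c : ℝ) (m : ℕ) :
    ffall (c + (m : ℝ)) (m + 1) = ∏ j ∈ Finset.range (m + 1), (c + (j : ℝ)) := by
  rw [ffall, ← Finset.prod_range_reflect]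
  refine Finset.prod_congr rfl fun j hj => ?_
  have hj' : j < m + 1 := Finset.mem_range.mp hj
  rw [Nat.add_sub_cancel, Nat.cast_sub (by omega)]
  ring

theorem ringChoose_eq_risingCoeff (s : ℝ) (n : ℕ) :
    Ring.choose (s + n - 1) n = risingCoeff s n := by
  have h := Ring.factorial_nsmul_multichoose_eq_ascPochhammer s n
  have hprod : (ascPochhammer ℝ n).eval s = ∏ j ∈ Finset.range n, (s + (j : ℝ)) := by
    clear h
    induction n with
    | zero => simp
    | succ n ih => rw [ascPochhammer_succ_eval, ih, Finset.prod_range_succ]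
  rw [Ring.multichoose_eq, Polynomial.ascPochhammer_smeval_eq_eval, hprod, nsmul_eq_mul] at h
  rw [risingCoeff, ← h]
  field_simp

theorem sum_risingCoeff_mul_pow_le {s r : ℝ} (hs : 0 ≤ s) (hr : 0 ≤ r) (hr1 : r < 1) (N : ℕ) :
    ∑ l ∈ Finset.range N, risingCoeff s l * r ^ l ≤ (1 - r) ^ (-s) := by
  have hmem : r ∈ Metric.eball (0 : ℝ) 1 := by
    rw [Metric.mem_eball, edist_zero_right, ← ofReal_norm, Real.norm_of_nonneg hr]
    simpa using hr1
  have h := (Real.one_div_one_sub_rpow_hasFPowerSeriesOnBall_zero s).hasSum hmem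
  simp only [FormalMultilinearSeries.ofScalars_apply_eq, smul_eq_mul, zero_add,
    ringChoose_eq_risingCoeff] at h
  rw [Real.rpow_neg (by linarith), ← one_div]
  exact sum_le_hasSum _ (fun l _ => mul_nonneg (risingCoeff_nonneg hs l) (by positivity)) h

theorem sum_mul_risingCoeff_mul_pow_le {s r : ℝ} (hs : 0 ≤ s) (hr : 0 ≤ r) (hr1 : r < 1)
    (N : ℕ) :
    ∑ l ∈ Finset.range N, (l : ℝ) * (risingCoeff s l * r ^ l) ≤
      s * r * (1 - r) ^ (-(s + 1)) := by
  cases N with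
  | zero =>
    have : 0 ≤ (1 - r) ^ (-(s + 1)) := Real.rpow_nonneg (by linarith) _
    simpa using by positivity
  | succ N =>
    rw [Finset.sum_range_succ']
    have h : ∀ l ∈ Finset.range N,
        ((l + 1 : ℕ) : ℝ) * (risingCoeff s (l + 1) * r ^ (l + 1)) =
          s * r * (risingCoeff (s + 1) l * r ^ l) := fun l _ => by
      have := succ_mul_risingCoeff_succ' s l
      push_cast
      rw [← mul_assoc, this]
      ring
    rw [Finset.sum_congr rfl h, ← Finset.mul_sum]
    simpa using mul_le_mul_of_nonneg_left
      (sum_risingCoeff_mul_pow_le (by linarith : 0 ≤ s + 1) hr hr1 N) (by positivity)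

/-- A convolution of the coefficients of `(1 - x) ^ (-s)` with the reciprocals of the integers. -/
theorem sum_risingCoeff_mul_pow_div_le {s r : ℝ} (hs : 0 ≤ s) (hr : 0 ≤ r) (hr1 : r < 1)
    {M : ℕ} (hM : 0 < M) :
    ∑ l ∈ Finset.range M, risingCoeff s l * r ^ l / ((M : ℝ) - l) ≤
      ((1 - r) ^ (-s) + s * r * (1 - r) ^ (-(s + 1))) / M := by
  have hM' : (0 : ℝ) < M := by exact_mod_cast hM
  rw [le_div_iff₀ hM', Finset.sum_mul]
  refine le_trans ?_ (add_le_add (sum_risingCoeff_mul_pow_le hs hr hr1 M)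
    (sum_mul_risingCoeff_mul_pow_le hs hr hr1 M))
  rw [← Finset.sum_add_distrib]
  refine Finset.sum_le_sum fun l hl => ?_
  have hl' : (l : ℝ) + 1 ≤ M := by exact_mod_cast Finset.mem_range.mp hl
  have hu : 0 ≤ risingCoeff s l * r ^ l := mul_nonneg (risingCoeff_nonneg hs l) (by positivity)
  have hd : (0 : ℝ) < M - l := by linarith
  have hMl : (M : ℝ) / (M - l) ≤ 1 + l := by
    rw [div_le_iff₀ hd]
    nlinarith [(Nat.cast_nonneg l : (0 : ℝ) ≤ l)]
  calc risingCoeff s l * r ^ l / ((M : ℝ) - l) * M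
      = risingCoeff s l * r ^ l * (M / (M - l)) := by ring
    _ ≤ risingCoeff s l * r ^ l * (1 + l) := by gcongr
    _ = _ := by ring

theorem HasFPowerSeriesAt.iteratedDeriv_ofScalars {f : ℝ → ℝ} {b : ℕ → ℝ}
    (h : HasFPowerSeriesAt f (FormalMultilinearSeries.ofScalars ℝ b) 0) (n : ℕ) :
    iteratedDeriv n f 0 = (Nat.factorial n : ℝ) * b n := by
  obtain ⟨R, hR⟩ := h
  have := hR.factorial_smul 1 n
  rw [FormalMultilinearSeries.ofScalars_apply_eq] at this
  rw [iteratedDeriv_eq_iteratedFDeriv, ← this]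
  simp

theorem hasFPowerSeriesAt_tsum_of_abs_le {b : ℕ → ℝ} {C ρ : ℝ} (hρ : 0 < ρ)
    (hb : ∀ n, |b n| ≤ C / ρ ^ n) :
    HasFPowerSeriesAt (fun x => ∑' n, b n * x ^ n) (FormalMultilinearSeries.ofScalars ℝ b) 0 := by
  have hrad : ENNReal.ofReal ρ ≤ (FormalMultilinearSeries.ofScalars ℝ b).radius := by
    refine FormalMultilinearSeries.le_radius_of_bound _ C (r := ρ.toNNReal) fun n => ?_
    rw [FormalMultilinearSeries.ofScalars_norm, Real.coe_toNNReal _ hρ.le, Real.norm_eq_abs]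
    exact (le_div_iff₀ (by positivity)).mp (hb n)
  have hpos : 0 < (FormalMultilinearSeries.ofScalars ℝ b).radius :=
    lt_of_lt_of_le (ENNReal.ofReal_pos.mpr hρ) hrad
  have h := (FormalMultilinearSeries.hasFPowerSeriesOnBall _ hpos).hasFPowerSeriesAt
  have hs : (FormalMultilinearSeries.ofScalars ℝ b).sum = fun x => ∑' n, b n * x ^ n := by
    ext x
    exact tsum_congr fun n => by
      rw [FormalMultilinearSeries.ofScalars_apply_eq, smul_eq_mul]
  rwa [hs] at h

theorem iteratedDeriv_succ_exp_comp {g : ℝ → ℝ} {x : ℝ} (hg : AnalyticAt ℝ g x) (n : ℕ) :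
    iteratedDeriv (n + 1) (fun y => Real.exp (g y)) x =
      ∑ i ∈ Finset.range (n + 1), (n.choose i : ℝ) *
        iteratedDeriv i (fun y => Real.exp (g y)) x * iteratedDeriv (n - i + 1) g x := by
  have hd : deriv (fun y => Real.exp (g y)) =ᶠ[nhds x]
      (fun y => Real.exp (g y)) * deriv g := by
    filter_upwards [hg.eventually_analyticAt] with y hy
    exact hy.differentiableAt.hasDerivAt.exp.deriv
  have he : AnalyticAt ℝ (fun y => Real.exp (g y)) x := hg.rexp
  rw [iteratedDeriv_succ', hd.iteratedDeriv_eq,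
    iteratedDeriv_mul he.contDiffAt hg.deriv.contDiffAt]
  simp only [← iteratedDeriv_succ']

/-- Majorisation of the coefficients of `exp (∑ tₙ xⁿ / n)` by those of `(1 - x / α) ^ (-c)`. -/
theorem abs_iteratedDeriv_exp_div_factorial_le {α c : ℝ} (hα : 0 < α) (hc : 0 ≤ c) {t : ℕ → ℝ}
    (ht : ∀ k : ℕ, 1 ≤ k → |t k| ≤ c / α ^ k) (n : ℕ) :
    |iteratedDeriv n (fun x => Real.exp (∑' k : ℕ, t (k + 1) * x ^ (k + 1) / ((k : ℝ) + 1))) 0 /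
        (Nat.factorial n : ℝ)| ≤ risingCoeff c n / α ^ n := by
  set b : ℕ → ℝ := fun k => if k = 0 then 0 else t k / k with hb_def
  have hb : ∀ k, |b k| ≤ c / α ^ k := by
    intro k
    rcases Nat.eq_zero_or_pos k with rfl | hk
    · simpa [hb_def] using hc
    · have hk1 : (1 : ℝ) ≤ k := by exact_mod_cast hk
      simp only [hb_def, hk.ne', if_false]
      rw [abs_div, abs_of_pos (by linarith : (0 : ℝ) < k)]
      exact (div_le_self (abs_nonneg _) hk1).trans (ht k hk)
  set g : ℝ → ℝ := fun x => ∑' k : ℕ, t (k + 1) * x ^ (k + 1) / ((k : ℝ) + 1) with hg_def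
  have hg : HasFPowerSeriesAt g (FormalMultilinearSeries.ofScalars ℝ b) 0 := by
    have h := hasFPowerSeriesAt_tsum_of_abs_le hα hb
    convert h using 2 with x
    simp only [hg_def]
    rw [← tsum_eq_tsum_of_ne_zero_bij (fun k : Function.support
      (fun k : ℕ => t (k + 1) * x ^ (k + 1) / ((k : ℝ) + 1)) => (k : ℕ) + 1)]
    · intro i j h
      exact Subtype.ext (by simpa using h)
    · intro k hk
      rcases k with _ | k
      · simp [hb_def] at hk
      · refine ⟨⟨k, ?_⟩, rfl⟩
        simpa [hb_def, div_mul_eq_mul_div] using hk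
    · intro k
      simp [hb_def, div_mul_eq_mul_div]
  have hgd : ∀ k, iteratedDeriv (k + 1) g 0 = (Nat.factorial k : ℝ) * t (k + 1) := by
    intro k
    rw [hg.iteratedDeriv_ofScalars, Nat.factorial_succ]
    have : (k : ℝ) + 1 ≠ 0 := by positivity
    simp only [hb_def, Nat.succ_ne_zero, if_false]
    push_cast
    field_simp
  set A : ℕ → ℝ := fun k => iteratedDeriv k (fun x => Real.exp (g x)) 0 / (Nat.factorial k : ℝ)
    with hA_def
  have hrec : ∀ k : ℕ, ((k : ℝ) + 1) * A (k + 1) =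
      ∑ i ∈ Finset.range (k + 1), A i * t (k - i + 1) := by
    intro k
    have h0 : (k : ℝ) + 1 ≠ 0 := by positivity
    have h1 : (Nat.factorial k : ℝ) ≠ 0 := by positivity
    simp only [hA_def]
    rw [iteratedDeriv_succ_exp_comp hg.analyticAt, Nat.factorial_succ, Nat.cast_mul,
      Nat.cast_succ, ← mul_div_assoc, mul_div_mul_left _ _ h0, Finset.sum_div]
    refine Finset.sum_congr rfl fun i hi => ?_
    have hik : i ≤ k := Nat.lt_succ_iff.mp (Finset.mem_range.mp hi)
    have h2 : (Nat.factorial i : ℝ) ≠ 0 := by positivity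
    rw [hgd, ← Nat.choose_mul_factorial_mul_factorial hik]
    have h3 : (Nat.factorial (k - i) : ℝ) ≠ 0 := by positivity
    have h4 : (k.choose i : ℝ) ≠ 0 := by
      exact_mod_cast (Nat.choose_pos hik).ne'
    push_cast
    field_simp
  change |A n| ≤ _
  induction n using Nat.strong_induction_on with
  | _ n ih =>
    rcases n with _ | n
    · have hg0 : g 0 = 0 := by simp [hg_def]
      simp [hA_def, hg0]
    · have h0 : (0 : ℝ) < (n : ℝ) + 1 := by positivity
      refine le_of_mul_le_mul_left ?_ h0
      calc ((n : ℝ) + 1) * |A (n + 1)| = |((n : ℝ) + 1) * A (n + 1)| := by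
            rw [abs_mul, abs_of_pos h0]
        _ ≤ ∑ i ∈ Finset.range (n + 1), |A i * t (n - i + 1)| := by
            rw [hrec]; exact Finset.abs_sum_le_sum_abs _ _
        _ ≤ ∑ i ∈ Finset.range (n + 1), c / α ^ (n + 1) * risingCoeff c i := by
            refine Finset.sum_le_sum fun i hi => ?_
            have hin : i < n + 1 := Finset.mem_range.mp hi
            rw [abs_mul]
            calc |A i| * |t (n - i + 1)|
                ≤ risingCoeff c i / α ^ i * (c / α ^ (n - i + 1)) :=
                  mul_le_mul (ih i hin) (ht _ (by omega)) (abs_nonneg _)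
                    (div_nonneg (risingCoeff_nonneg hc i) (by positivity))
              _ = c / α ^ (n + 1) * risingCoeff c i := by
                  have hpow : α ^ (n + 1) = α ^ i * α ^ (n - i + 1) := by
                    rw [← pow_add]
                    congr 1
                    omega
                  rw [hpow]
                  field_simp
        _ = ((n : ℝ) + 1) * (risingCoeff c (n + 1) / α ^ (n + 1)) := by
            rw [← Finset.mul_sum, sum_range_succ_risingCoeff, ← mul_div_assoc,
              succ_mul_risingCoeff_succ']
            ring

theorem risingCoeff_le_one {s : ℝ} (hs : 0 ≤ s) (hs1 : s ≤ 1) (n : ℕ) : risingCoeff s n ≤ 1 := by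
  induction n with
  | zero => simp
  | succ n ih =>
    have h0 : (0 : ℝ) < (n : ℝ) + 1 := by positivity
    refine le_of_mul_le_mul_left ?_ h0
    rw [succ_mul_risingCoeff_succ]
    nlinarith [risingCoeff_nonneg hs n, (Nat.cast_nonneg n : (0 : ℝ) ≤ n)]

theorem one_le_risingCoeff {s : ℝ} (hs : 1 ≤ s) (n : ℕ) : 1 ≤ risingCoeff s n := by
  induction n with
  | zero => simp
  | succ n ih =>
    have h0 : (0 : ℝ) < (n : ℝ) + 1 := by positivity
    refine le_of_mul_le_mul_left ?_ h0
    rw [succ_mul_risingCoeff_succ]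
    nlinarith [(Nat.cast_nonneg n : (0 : ℝ) ≤ n)]

theorem choose_le_rbinom {x : ℝ} {N k : ℕ} (hx : (N : ℝ) ≤ x) (hk : k ≤ N) :
    (N.choose k : ℝ) ≤ rbinom x k := by
  rw [rbinom, le_div_iff₀ (by positivity), mul_comm, ← Nat.cast_mul,
    ← Nat.descFactorial_eq_factorial_mul_choose, Nat.descFactorial_eq_prod_range, Nat.cast_prod]
  refine Finset.prod_le_prod (fun _ _ => by positivity) fun j hj => ?_
  rw [Nat.cast_sub ((Finset.mem_range.mp hj).le.trans hk)]
  linarith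

theorem rbinom_sub_mem_Icc {c : ℝ} (hc : c ∈ Set.Ioo (0 : ℝ) 1) (k : ℕ) :
    rbinom ((k : ℝ) - c) k ∈ Set.Icc (0 : ℝ) 1 := by
  have h : (k : ℝ) - c = k + (1 - c) - 1 := by ring
  rw [h, rbinom_add_sub_one]
  exact ⟨risingCoeff_nonneg (by linarith [hc.2]) k,
    risingCoeff_le_one (by linarith [hc.2]) (by linarith [hc.1]) k⟩

theorem sum_Icc_choose_div_choose {i N m : ℕ} (hmi : m ≤ i) (hiN : i ≤ N) :
    ∑ k ∈ Finset.Icc (m + 1) i, (i.choose k : ℝ) / (N.choose k : ℝ) =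
      ((m : ℝ) + 1) * (i.choose (m + 1) : ℝ) / ((N.choose m : ℝ) * ((N : ℝ) + 1 - i)) := by
  have hiN' : (i : ℝ) ≤ N := by exact_mod_cast hiN
  have hd : (N : ℝ) + 1 - i ≠ 0 := by linarith
  have hstep : ∀ a k : ℕ, k ≤ a →
      (a.choose (k + 1) : ℝ) * ((k : ℝ) + 1) = a.choose k * ((a : ℝ) - k) := by
    intro a k hk
    rw [← Nat.cast_sub hk]
    exact_mod_cast Nat.choose_succ_right_eq a k
  have key : ∀ j, m ≤ j → j ≤ i →
      (∑ k ∈ Finset.Icc (m + 1) j, (i.choose k : ℝ) / (N.choose k : ℝ)) * ((N : ℝ) + 1 - i) =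
        (i.choose m : ℝ) / (N.choose m : ℝ) * ((i : ℝ) - m) -
          (i.choose j : ℝ) / (N.choose j : ℝ) * ((i : ℝ) - j) := by
    intro j hmj
    induction j, hmj using Nat.le_induction with
    | base => simp
    | succ j hmj ih =>
      intro hji
      rw [← Finset.insert_Icc_right_eq_Icc_add_one (by omega), Finset.sum_insert (by simp),
        add_mul, ih (by omega)]
      have h1 := hstep i j (by omega)
      have h2 := hstep N j (by omega)
      have hN : (N.choose j : ℝ) ≠ 0 := by exact_mod_cast (Nat.choose_pos (by omega)).ne'
      have hN' : (N.choose (j + 1) : ℝ) ≠ 0 := by exact_mod_cast (Nat.choose_pos (by omega)).ne'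
      have hj0 : (j : ℝ) + 1 ≠ 0 := by positivity
      have hcross : (i.choose (j + 1) : ℝ) / (N.choose (j + 1) : ℝ) * ((N : ℝ) - j) =
          (i.choose j : ℝ) / (N.choose j : ℝ) * ((i : ℝ) - j) := by
        rw [div_mul_eq_mul_div, div_mul_eq_mul_div, div_eq_div_iff hN' hN, ← h1, mul_assoc,
          mul_comm ((N : ℝ) - j), ← h2]
        ring
      push_cast
      linear_combination hcross
  have h := key i hmi le_rfl
  rw [sub_self, mul_zero, sub_zero, div_mul_eq_mul_div, ← hstep i m hmi] at h
  rw [mul_comm ((m : ℝ) + 1), ← div_div, ← h, mul_div_assoc, div_self hd, mul_one]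

theorem sum_weights_le {c : ℝ} (hc : c ∈ Set.Ioo (0 : ℝ) 1) {i N m : ℕ} (hmi : m ≤ i)
    (hiN : i ≤ N) {x : ℝ} (hx : (N : ℝ) ≤ x) :
    ∑ k ∈ Finset.Icc (m + 1) i, (i.choose k : ℝ) * rbinom ((k : ℝ) - c) k / rbinom x k ≤
      ((m : ℝ) + 1) * (i.choose (m + 1) : ℝ) / ((N.choose m : ℝ) * ((N : ℝ) + 1 - i)) := by
  rw [← sum_Icc_choose_div_choose hmi hiN]
  refine Finset.sum_le_sum fun k hk => ?_
  have hk' : k ≤ N := (Finset.mem_Icc.mp hk).2.trans hiN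
  have hpos : (0 : ℝ) < N.choose k := by exact_mod_cast Nat.choose_pos hk'
  refine div_le_div₀ (by positivity) ?_ hpos (choose_le_rbinom hx hk')
  exact mul_le_of_le_one_right (by positivity) (rbinom_sub_mem_Icc hc k).2

theorem sum_weights_nonneg {c : ℝ} (hc : c ∈ Set.Ioo (0 : ℝ) 1) {i n : ℕ} (m : ℕ) (hin : i ≤ n) :
    0 ≤ ∑ k ∈ Finset.Icc (m + 1) i,
      (i.choose k : ℝ) * rbinom ((k : ℝ) - c) k / rbinom ((n : ℝ) + c - 1) k := by
  refine Finset.sum_nonneg fun k hk => div_nonneg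
    (mul_nonneg (by positivity) (rbinom_sub_mem_Icc hc k).1)
    (div_nonneg (Finset.prod_nonneg fun j hj => ?_) (by positivity))
  have h : j + 1 ≤ n := by
    have := Finset.mem_range.mp hj
    have := (Finset.mem_Icc.mp hk).2
    omega
  have h' : (j : ℝ) + 1 ≤ n := by exact_mod_cast h
  linarith [hc.1]

theorem div_le_rbinom_self {c : ℝ} (hc : 0 < c) (N : ℕ) :
    c / ((N : ℝ) + 1) ≤ rbinom (((N + 1 : ℕ) : ℝ) + c - 1) (N + 1) := by
  rw [rbinom_add_sub_one, div_le_iff₀ (by positivity), mul_comm, succ_mul_risingCoeff_succ']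
  exact le_mul_of_one_le_right hc.le (one_le_risingCoeff (by linarith) N)

theorem sum_Icc_one_div_le (N m : ℕ) :
    ∑ k ∈ Finset.Icc (m + 1) N, ((N : ℝ) + 1) / ((N : ℝ) + 1 - k) ≤
      ((N : ℝ) + 1) * (1 + Real.log ((N : ℝ) + 1)) := by
  have hterm : ∀ k ∈ Finset.Icc 1 N, (0 : ℝ) < (N : ℝ) + 1 - k := by
    intro k hk
    have : (k : ℝ) ≤ N := by exact_mod_cast (Finset.mem_Icc.mp hk).2
    linarith
  have hharm : ∑ k ∈ Finset.Icc 1 N, ((N : ℝ) + 1 - k)⁻¹ = (harmonic N : ℝ) := by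
    rw [harmonic_eq_sum_Icc, Rat.cast_sum]
    refine Finset.sum_nbij' (fun k => N + 1 - k) (fun k => N + 1 - k) ?_ ?_ ?_ ?_ ?_
    · simp only [Finset.mem_Icc]; omega
    · simp only [Finset.mem_Icc]; omega
    · simp only [Finset.mem_Icc]; omega
    · simp only [Finset.mem_Icc]; omega
    · intro k hk
      rw [Nat.cast_sub (by have := (Finset.mem_Icc.mp hk).2; omega)]
      push_cast
      rfl
  have hlog : Real.log N ≤ Real.log ((N : ℝ) + 1) := by
    rcases Nat.eq_zero_or_pos N with rfl | hN
    · simp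
    · exact Real.log_le_log (by exact_mod_cast hN) (by linarith)
  calc ∑ k ∈ Finset.Icc (m + 1) N, ((N : ℝ) + 1) / ((N : ℝ) + 1 - k)
      ≤ ∑ k ∈ Finset.Icc 1 N, ((N : ℝ) + 1) / ((N : ℝ) + 1 - k) :=
        Finset.sum_le_sum_of_subset_of_nonneg (Finset.Icc_subset_Icc_left (by omega))
          fun k hk _ => div_nonneg (by positivity) (hterm k hk).le
    _ = ((N : ℝ) + 1) * (harmonic N : ℝ) := by
        rw [← hharm, Finset.mul_sum]
        rfl
    _ ≤ _ := by
        have := harmonic_le_one_add_log N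
        gcongr
        linarith

theorem sum_weights_self_le {c : ℝ} (hc : c ∈ Set.Ioo (0 : ℝ) 1) {m n : ℕ} (hmn : m < n) :
    ∑ k ∈ Finset.Icc (m + 1) n,
        (n.choose k : ℝ) * rbinom ((k : ℝ) - c) k / rbinom ((n : ℝ) + c - 1) k ≤
      (n : ℝ) * Real.log n + 2 * n / c := by
  obtain ⟨N, rfl⟩ : ∃ N, n = N + 1 := ⟨n - 1, by omega⟩
  have hN1 : (0 : ℝ) < (N : ℝ) + 1 := by positivity
  rw [← Finset.insert_Icc_right_eq_Icc_add_one (by omega), Finset.sum_insert (by simp)]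
  have hlast : ((N + 1).choose (N + 1) : ℝ) * rbinom (((N + 1 : ℕ) : ℝ) - c) (N + 1) /
      rbinom (((N + 1 : ℕ) : ℝ) + c - 1) (N + 1) ≤ ((N : ℝ) + 1) / c := by
    rw [Nat.choose_self, Nat.cast_one, one_mul, ← one_div_div c]
    exact div_le_div₀ zero_le_one (rbinom_sub_mem_Icc hc _).2 (div_pos hc.1 hN1)
      (div_le_rbinom_self hc.1 N)
  have hrest : ∑ k ∈ Finset.Icc (m + 1) N, ((N + 1).choose k : ℝ) * rbinom ((k : ℝ) - c) k /
      rbinom (((N + 1 : ℕ) : ℝ) + c - 1) k ≤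
      ∑ k ∈ Finset.Icc (m + 1) N, ((N : ℝ) + 1) / ((N : ℝ) + 1 - k) := by
    refine Finset.sum_le_sum fun k hk => ?_
    have hk' : k ≤ N := (Finset.mem_Icc.mp hk).2
    have hk'' : (k : ℝ) ≤ N := by exact_mod_cast hk'
    have hpos : (0 : ℝ) < N.choose k := by exact_mod_cast Nat.choose_pos hk'
    have hch : ((N + 1).choose k : ℝ) * ((N : ℝ) + 1 - k) = N.choose k * ((N : ℝ) + 1) := by
      have := Nat.choose_mul_succ_eq N k
      rw [show (N : ℝ) + 1 - k = ((N + 1 - k : ℕ) : ℝ) by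
        rw [Nat.cast_sub (by omega)]; push_cast; rfl]
      exact_mod_cast this.symm
    calc _ ≤ ((N + 1).choose k : ℝ) / (N.choose k : ℝ) :=
          div_le_div₀ (by positivity)
            (mul_le_of_le_one_right (by positivity) (rbinom_sub_mem_Icc hc k).2) hpos
            (choose_le_rbinom (by push_cast; linarith [hc.1]) hk')
      _ = _ := by
          rw [div_eq_div_iff hpos.ne' (by linarith), hch]
          ring
  have hc1 : (N : ℝ) + 1 ≤ ((N : ℝ) + 1) / c :=
    (le_div_iff₀ hc.1).mpr (mul_le_of_le_one_right hN1.le hc.2.le)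
  have := sum_Icc_one_div_le N m
  push_cast at *
  rw [mul_div_assoc 2]
  linarith

theorem risingCoeff_mul_choose (c : ℝ) (m l : ℕ) :
    risingCoeff c (m + 1 + l) * ((m + 1 + l).choose (m + 1) : ℝ) * (Nat.factorial (m + 1) : ℝ) =
      ffall (c + (m : ℝ)) (m + 1) * risingCoeff (c + m + 1) l := by
  have hp : ∏ j ∈ Finset.range l, (c + ((m + 1 + j : ℕ) : ℝ)) =
      ∏ j ∈ Finset.range l, (c + m + 1 + (j : ℝ)) :=
    Finset.prod_congr rfl fun j _ => by push_cast; ring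
  have hfac : ((m + 1 + l).choose (m + 1) : ℝ) * (Nat.factorial (m + 1) : ℝ) *
      (Nat.factorial l : ℝ) = (Nat.factorial (m + 1 + l) : ℝ) := by
    have := Nat.choose_mul_factorial_mul_factorial (Nat.le_add_right (m + 1) l)
    rw [Nat.add_sub_cancel_left] at this
    exact_mod_cast this
  have h1 : (Nat.factorial l : ℝ) ≠ 0 := by positivity
  have h2 : (Nat.factorial (m + 1 + l) : ℝ) ≠ 0 := by positivity
  rw [ffall_add_succ, risingCoeff, risingCoeff, Finset.prod_range_add, hp, mul_assoc,
    div_mul_eq_mul_div, ← mul_div_assoc, div_eq_div_iff h2 h1, ← hfac]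
  ring

theorem sum_pow_mul_risingCoeff_mul_choose_div (r c : ℝ) (m N : ℕ) :
    ∑ i ∈ Finset.Icc (m + 1) N, r ^ i * risingCoeff c i *
        (((m : ℝ) + 1) * (i.choose (m + 1) : ℝ) / ((N.choose m : ℝ) * ((N : ℝ) + 1 - i))) =
      ffall (c + (m : ℝ)) (m + 1) * r ^ (m + 1) / (N.descFactorial m : ℝ) *
        ∑ l ∈ Finset.range (N - m), risingCoeff (c + m + 1) l * r ^ l / (((N - m : ℕ) : ℝ) - l) := by
  rw [show Finset.Icc (m + 1) N = Finset.Ico (m + 1) (N + 1) by ext; simp,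
    Finset.sum_Ico_eq_sum_range, Nat.add_sub_add_right, Finset.mul_sum]
  refine Finset.sum_congr rfl fun l hl => ?_
  have hl' : l < N - m := Finset.mem_range.mp hl
  have hd : (N : ℝ) + 1 - ((m + 1 + l : ℕ) : ℝ) = ((N - m : ℕ) : ℝ) - l := by
    rw [Nat.cast_sub (by omega)]
    push_cast
    ring
  have hd0 : ((N - m : ℕ) : ℝ) - l ≠ 0 := by
    have : (l : ℝ) < ((N - m : ℕ) : ℝ) := by exact_mod_cast hl'
    linarith
  have hc0 : (N.choose m : ℝ) ≠ 0 := by exact_mod_cast (Nat.choose_pos (by omega)).ne'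
  have hf0 : (Nat.factorial m : ℝ) ≠ 0 := by positivity
  have h := risingCoeff_mul_choose c m l
  rw [Nat.factorial_succ] at h
  push_cast at h
  rw [hd, Nat.descFactorial_eq_factorial_mul_choose, pow_add]
  push_cast
  field_simp
  linear_combination r ^ l * r ^ (m + 1) * h

theorem inv_one_sub_pow_le {r : ℝ} (hr : r ≤ 1 / Real.sqrt 2) (m : ℕ) :
    ((1 - r) ^ (m + 2))⁻¹ ≤ 12 * 4 ^ m := by
  have hr' : r ≤ 0.7072 := by
    refine hr.trans ?_
    rw [div_le_iff₀ (by positivity)]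
    have : (1.4141 : ℝ) ≤ Real.sqrt 2 := Real.le_sqrt_of_sq_le (by norm_num)
    linarith
  have h1 : (1 / 12 : ℝ) ≤ (1 - r) ^ 2 := by nlinarith
  have h2 : (1 / 4 : ℝ) ^ m ≤ (1 - r) ^ m := by
    gcongr
    linarith
  have h3 : (1 / 4 : ℝ) ^ m * (1 / 12) ≤ (1 - r) ^ (m + 2) := by
    rw [pow_add]
    exact mul_le_mul h2 h1 (by norm_num) (pow_nonneg (by linarith) m)
  refine (inv_anti₀ (by positivity) h3).trans (le_of_eq ?_)
  rw [mul_inv, one_div, inv_pow, inv_inv]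
  norm_num
  ring

theorem tail_sum_le {r c : ℝ} (hr0 : 0 < r) (hr1 : r < 1) (hr : r ≤ 1 / Real.sqrt 2)
    (hc : 0 < c) {m N : ℕ} (hmN : m ≤ N) :
    ∑ i ∈ Finset.Icc (m + 1) N, r ^ i * risingCoeff c i *
        (((m : ℝ) + 1) * (i.choose (m + 1) : ℝ) / ((N.choose m : ℝ) * ((N : ℝ) + 1 - i))) ≤
      ((m : ℝ) + 2) * ((m : ℝ) + 1) ^ (m + 1) * (12 * 4 ^ m) *
        ((r / ((N : ℝ) + 1)) ^ (m + 1) * ffall (c + (m : ℝ)) (m + 1) * (1 - r) ^ (-c) *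
          (1 + c * r)) := by
  have h1r : 0 < 1 - r := by linarith
  have hP : 0 ≤ ffall (c + (m : ℝ)) (m + 1) := by
    rw [ffall_add_succ]
    exact Finset.prod_nonneg fun j _ => by positivity
  have hX : 0 < (1 - r) ^ (-c) := Real.rpow_pos_of_pos h1r _
  have hcr : 0 < 1 + c * r := by positivity
  have hn : (0 : ℝ) < (N : ℝ) + 1 := by positivity
  rw [sum_pow_mul_risingCoeff_mul_choose_div]
  rcases Nat.eq_zero_or_pos (N - m) with hM | hM
  · rw [hM, Finset.sum_range_zero, mul_zero]
    positivity
  have hs : 0 ≤ c + m + 1 := by positivity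
  have hpow : ∀ k : ℕ, (1 - r) ^ (-(c + k)) = (1 - r) ^ (-c) * ((1 - r) ^ k)⁻¹ := by
    intro k
    rw [neg_add, Real.rpow_add h1r, Real.rpow_neg h1r.le (k : ℝ), Real.rpow_natCast]
  have hinner : (1 - r) ^ (-(c + m + 1)) + (c + m + 1) * r * (1 - r) ^ (-(c + m + 1 + 1)) ≤
      (1 - r) ^ (-c) * (12 * 4 ^ m) * (((m : ℝ) + 1) * (1 + c * r)) := by
    have e1 := hpow (m + 1)
    have e2 := hpow (m + 2)
    push_cast at e1 e2
    rw [show c + m + 1 + 1 = c + (m + 2) by ring, show -(c + (m : ℝ) + 1) = -(c + (m + 1)) by ring,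
      e1, e2]
    calc _ = (1 - r) ^ (-c) * ((1 - r) ^ (m + 2))⁻¹ * (1 + (c + m) * r) := by
          rw [pow_succ (1 - r) (m + 1)]
          field_simp
          ring
      _ ≤ _ := by
          have := inv_one_sub_pow_le hr m
          have h2 : 1 + (c + m) * r ≤ ((m : ℝ) + 1) * (1 + c * r) := by
            have : (m : ℝ) * r ≤ m := mul_le_of_le_one_right (by positivity) hr1.le
            have : (0 : ℝ) ≤ m * (c * r) := by positivity
            nlinarith
          gcongr
  have hMn : (((N - m : ℕ) : ℝ))⁻¹ ≤ ((m : ℝ) + 2) / ((N : ℝ) + 1) := by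
    rw [inv_le_comm₀ (by exact_mod_cast hM) (by positivity), inv_div, div_le_iff₀ (by positivity)]
    obtain ⟨d, rfl⟩ : ∃ d, N = m + 1 + d := ⟨N - m - 1, by omega⟩
    rw [show m + 1 + d - m = d + 1 by omega]
    push_cast
    nlinarith [(Nat.cast_nonneg d : (0 : ℝ) ≤ d), (Nat.cast_nonneg m : (0 : ℝ) ≤ m),
      mul_nonneg (Nat.cast_nonneg d : (0 : ℝ) ≤ d) (Nat.cast_nonneg m : (0 : ℝ) ≤ m)]
  have hdesc : ((N.descFactorial m : ℝ))⁻¹ ≤ (((m : ℝ) + 1) / ((N : ℝ) + 1)) ^ m := by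
    have h1 : (((N + 1 - m : ℕ) : ℝ)) ^ m ≤ (N.descFactorial m : ℝ) := by
      exact_mod_cast Nat.pow_sub_le_descFactorial N m
    have h2 : ((N : ℝ) + 1) / ((m : ℝ) + 1) ≤ ((N + 1 - m : ℕ) : ℝ) := by
      rw [div_le_iff₀ (by positivity)]
      obtain ⟨d, rfl⟩ : ∃ d, N = m + d := ⟨N - m, by omega⟩
      rw [show m + d + 1 - m = d + 1 by omega]
      push_cast
      nlinarith [mul_nonneg (Nat.cast_nonneg d : (0 : ℝ) ≤ d) (Nat.cast_nonneg m : (0 : ℝ) ≤ m)]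
    rw [← inv_div, inv_pow]
    refine inv_anti₀ (by positivity) (le_trans ?_ h1)
    gcongr
  calc _ ≤ ffall (c + (m : ℝ)) (m + 1) * r ^ (m + 1) / (N.descFactorial m : ℝ) *
        (((1 - r) ^ (-(c + m + 1)) + (c + m + 1) * r * (1 - r) ^ (-(c + m + 1 + 1))) /
          ((N - m : ℕ) : ℝ)) := by
        gcongr
        exact sum_risingCoeff_mul_pow_div_le hs hr0.le hr1 hM
    _ ≤ ffall (c + (m : ℝ)) (m + 1) * r ^ (m + 1) * (((m : ℝ) + 1) / ((N : ℝ) + 1)) ^ m *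
        ((1 - r) ^ (-c) * (12 * 4 ^ m) * (((m : ℝ) + 1) * (1 + c * r)) *
          (((m : ℝ) + 2) / ((N : ℝ) + 1))) := by
        rw [div_eq_mul_inv, div_eq_mul_inv _ ((N - m : ℕ) : ℝ)]
        gcongr
    _ = _ := by
        rw [div_pow, div_pow, pow_succ ((N : ℝ) + 1), pow_succ ((m : ℝ) + 1)]
        field_simp

/-- Main sum inequality: with `0 < β < α`, `r = β/α ≤ 1/√2`, `c₁ ∈ (0,1)`, `c₂ > 0`,
`|ãₙ| ≤ c₂/αⁿ`, `a(x) = exp(∑_{n≥1} ãₙxⁿ/n)` with coefficients `aᵢ = a⁽ⁱ⁾(0)/i!`: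
for `0 ≤ m < n`, the sum
`S₁ = ∑_{i=m+1}^{n} βⁱ (∑_{k=m+1}^{i} binom(i,k)binom(k−c₁,k)/binom(n+c₁−1,k)) aᵢ`
satisfies `|S₁| ≤ C_m (binom(n+c₂−1,n) rⁿ (n ln n + 2n/c₁)
 + (r/n)^{m+1}(c₂+m)_{m+1}(1−r)^{−c₂}(1+c₂r))` with `C_m` depending only on `m`, `C₀ = 24`. -/
theorem main_sum_inequality (m : ℕ) :
    ∃ Cm : ℝ, 0 < Cm ∧ (m = 0 → Cm = 24) ∧
      ∀ (α β c₁ c₂ : ℝ) (ta : ℕ → ℝ) (a : ℝ → ℝ),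
        0 < β → β < α → β / α ≤ 1 / Real.sqrt 2 →
        c₁ ∈ Set.Ioo (0 : ℝ) 1 → 0 < c₂ →
        (∀ k : ℕ, 1 ≤ k → |ta k| ≤ c₂ / α ^ k) →
        (∀ x : ℝ, a x = Real.exp (∑' k : ℕ, ta (k + 1) * x ^ (k + 1) / ((k : ℝ) + 1))) →
        ∀ n : ℕ, m < n →
          |∑ i ∈ Finset.Icc (m + 1) n, β ^ i *
              (∑ k ∈ Finset.Icc (m + 1) i,
                (Nat.choose i k : ℝ) * rbinom ((k : ℝ) - c₁) k / rbinom ((n : ℝ) + c₁ - 1) k) *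
              (iteratedDeriv i a 0 / (Nat.factorial i : ℝ))| ≤
            Cm * (rbinom ((n : ℝ) + c₂ - 1) n * (β / α) ^ n *
                ((n : ℝ) * Real.log (n : ℝ) + 2 * (n : ℝ) / c₁) +
              ((β / α) / (n : ℝ)) ^ (m + 1) * ffall (c₂ + (m : ℝ)) (m + 1) *
                (1 - β / α) ^ (-c₂) * (1 + c₂ * (β / α))) := by

  refine ⟨((m : ℝ) + 2) * ((m : ℝ) + 1) ^ (m + 1) * (12 * 4 ^ m), by positivity, ?_, ?_⟩
  · rintro rfl
    norm_num
  intro α β c₁ c₂ ta a hβ hβα hr hc₁ hc₂ hta ha n hmn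
  have hα : 0 < α := hβ.trans hβα
  have hr0 : 0 < β / α := div_pos hβ hα
  have hr1 : β / α < 1 := (div_lt_one hα).mpr hβα
  obtain rfl : a = _ := funext ha
  set T : ℕ → ℝ := fun i => ∑ k ∈ Finset.Icc (m + 1) i,
    (Nat.choose i k : ℝ) * rbinom ((k : ℝ) - c₁) k / rbinom ((n : ℝ) + c₁ - 1) k
  have hterm : ∀ i ∈ Finset.Icc (m + 1) n, ∀ A : ℝ, |A| ≤ risingCoeff c₂ i / α ^ i →
      |β ^ i * T i * A| ≤ (β / α) ^ i * risingCoeff c₂ i * T i := by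
    intro i hi A hA
    have hTi : 0 ≤ T i := sum_weights_nonneg hc₁ m (Finset.mem_Icc.mp hi).2
    rw [abs_mul, abs_of_nonneg (by positivity)]
    calc β ^ i * T i * |A| ≤ β ^ i * T i * (risingCoeff c₂ i / α ^ i) := by gcongr
      _ = _ := by rw [div_pow]; ring
  refine (Finset.abs_sum_le_sum_abs _ _).trans ((Finset.sum_le_sum fun i hi => hterm i hi _
    (abs_iteratedDeriv_exp_div_factorial_le hα hc₂.le hta i)).trans ?_)
  obtain ⟨N, rfl⟩ : ∃ N, n = N + 1 := ⟨n - 1, by omega⟩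
  rw [← Finset.insert_Icc_right_eq_Icc_add_one (by omega), Finset.sum_insert (by simp), mul_add]
  refine add_le_add ?_ ?_
  · have hp := risingCoeff_nonneg hc₂.le (N + 1)
    have hTn : T (N + 1) ≤ _ := sum_weights_self_le hc₁ hmn
    have hTn0 : 0 ≤ T (N + 1) := sum_weights_nonneg hc₁ m le_rfl
    have hC : (1 : ℝ) ≤ ((m : ℝ) + 2) * ((m : ℝ) + 1) ^ (m + 1) * (12 * 4 ^ m) := by
      have h1 : (1 : ℝ) ≤ ((m : ℝ) + 1) ^ (m + 1) := one_le_pow₀ (by simp)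
      have h2 : (1 : ℝ) ≤ 4 ^ m := one_le_pow₀ (by norm_num)
      have h3 : (1 : ℝ) ≤ (m : ℝ) + 2 := by
        linarith [(Nat.cast_nonneg m : (0 : ℝ) ≤ m)]
      exact one_le_mul_of_one_le_of_one_le (one_le_mul_of_one_le_of_one_le h3 h1) (by linarith)
    rw [rbinom_add_sub_one, mul_comm ((β / α) ^ (N + 1))]
    refine le_trans ?_ (le_mul_of_one_le_left ?_ hC)
    · gcongr
    · exact mul_nonneg (by positivity) (hTn0.trans hTn)
  · have h := tail_sum_le hr0 hr1 hr hc₂ (Nat.lt_succ_iff.mp hmn)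
    rw [Nat.cast_succ]
    refine le_trans (Finset.sum_le_sum fun i hi => ?_) h
    obtain ⟨hi1, hi2⟩ := Finset.mem_Icc.mp hi
    have hp := risingCoeff_nonneg hc₂.le i
    gcongr
    exact sum_weights_le hc₁ (by omega) hi2 (by push_cast; linarith [hc₁.1])
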